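/- Let N ≥ 1, let f, g, x : Fin N → ℝ, let p ∈ ℝ, and define Δ = Cov(f,x)² + 2(1−p)·Cov(g,x)·Cov(f,x) + (2p−3p²)·Cov(g,x)², where Cov denotes empirical covariance. Assume Cov(g,x) ≠ 0 and set k = Cov(f,x)/Cov(g,x). Then Δ < 0 if and only if either (p > (2+k)/3 and p > −k) or (p < (2+k)/3 and p < −k). -/

import Mathlib

/-- Empirical covariance of two vectors `u x : Fin N → ℝ`:
`Cov(u,x) = (1/N) ∑ i, (uᵢ - ū)(xᵢ - x̄)` where `ū = (1/N) ∑ i, uᵢ`. -/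
noncomputable def empCov {N : ℕ} (u x : Fin N → ℝ) : ℝ :=
  (1 / (N : ℝ)) * ∑ i, (u i - (1 / (N : ℝ)) * ∑ j, u j) * (x i - (1 / (N : ℝ)) * ∑ j, x j)

/-- With `Cov(g,x) ≠ 0` and `k = Cov(f,x)/Cov(g,x)`, `Δ < 0` iff
`(p > (2+k)/3 ∧ p > −k)` or `(p < (2+k)/3 ∧ p < −k)`. -/
theorem delta_neg_iff (N : ℕ) (hN : 1 ≤ N) (f g x : Fin N → ℝ) (p : ℝ)
    (hg : empCov g x ≠ 0) (k : ℝ) (hk : k = empCov f x / empCov g x) :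
    empCov f x ^ 2 + 2 * (1 - p) * empCov g x * empCov f x
        + (2 * p - 3 * p ^ 2) * empCov g x ^ 2 < 0
    ↔ ((2 + k) / 3 < p ∧ -k < p) ∨ (p < (2 + k) / 3 ∧ p < -k) := by
  have hf : empCov f x = k * empCov g x := by rw [hk, div_mul_cancel₀ _ hg]
  have hfactor : empCov f x ^ 2 + 2 * (1 - p) * empCov g x * empCov f x
        + (2 * p - 3 * p ^ 2) * empCov g x ^ 2
      = -(3 * empCov g x ^ 2 * ((p - (2 + k) / 3) * (p - -k))) := by
    rw [hf]; ring
  have hpos : 0 < 3 * empCov g x ^ 2 := by positivity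
  rw [hfactor, neg_lt_zero, mul_pos_iff_of_pos_left hpos, mul_pos_iff]
  simp only [sub_pos, sub_neg]
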